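/- arXiv:math/0611446 — 5 statements merged into one kernel-verified Lean document; each statement's English description precedes it below -/
import Mathlib

section
/- Let m : Fin n → ℝ satisfy 0 < m i for all i and the strict polygon inequalities m i < ∑_{j ≠ i} m j for all i. Then there exists a closed polygon with these side lengths, i.e. a function p : Fin n → EuclideanSpace ℝ (Fin 3) with ∑ i, p i = 0 and ‖p i‖ = m i for all i. -/
/-- A triangle with sides `v`, `w` and `v - w` exists for prescribed `v`, `‖w‖ = r` and
`‖v - w‖ = a` whenever the triangle inequalities hold. -/
theorem exists_norm_eq_norm_sub_eq {E : Type*} [NormedAddCommGroup E] [NormedSpace ℝ E]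
    (hE : 1 < Module.rank ℝ E) (v : E) {a r : ℝ} (hr : 0 ≤ r)
    (h₁ : ‖v‖ ≤ r + a) (h₂ : r ≤ ‖v‖ + a) (h₃ : a ≤ ‖v‖ + r) :
    ∃ w : E, ‖w‖ = r ∧ ‖v - w‖ = a := by
  have : Nontrivial E := rank_pos_iff_nontrivial.1 (zero_lt_one.trans hE)
  obtain ⟨u, hu, hv⟩ : ∃ u : E, ‖u‖ = 1 ∧ v = ‖v‖ • u := by
    rcases eq_or_ne v 0 with rfl | h
    · obtain ⟨u, hu⟩ := exists_norm_eq E zero_le_one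
      exact ⟨u, hu, by simp⟩
    · exact ⟨‖v‖⁻¹ • v, norm_smul_inv_norm h, by simp [smul_smul, h]⟩
  have hmem : ∀ c : ℝ, |c| = r → c • u ∈ Metric.sphere (0 : E) r := fun c hc ↦ by
    simp [norm_smul, hu, hc]
  have hdist : ∀ c : ℝ, ‖v - c • u‖ = |‖v‖ - c| := fun c ↦ by
    nth_rw 1 [hv]
    rw [← sub_smul, norm_smul, hu, mul_one, Real.norm_eq_abs]
  obtain ⟨w, hw, hwa⟩ := (isPreconnected_sphere hE (0 : E) r).intermediate_value
    (hmem r (abs_of_nonneg hr)) (hmem (-r) (by rw [abs_neg, abs_of_nonneg hr]))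
    (f := fun w ↦ ‖v - w‖) (by fun_prop)
    (show a ∈ Set.Icc _ _ by
      simp only [hdist, sub_neg_eq_add, Set.mem_Icc]
      exact ⟨abs_le.2 ⟨by linarith, by linarith⟩, h₃.trans (le_abs_self _)⟩)
  exact ⟨w, by simpa using hw, hwa⟩

/-- An open polygonal chain with nonnegative side lengths `m i` and prescribed total displacement
`v` exists whenever the polygon inequalities for the lengths `m i` and `‖v‖` hold. -/
theorem exists_sum_eq_norm_eq {ι E : Type*} [DecidableEq ι] [NormedAddCommGroup E]
    [NormedSpace ℝ E] (hE : 1 < Module.rank ℝ E) (m : ι → ℝ) (s : Finset ι)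
    (hm : ∀ i ∈ s, 0 ≤ m i) (v : E) (hv : ‖v‖ ≤ ∑ i ∈ s, m i)
    (hs : ∀ i ∈ s, 2 * m i ≤ ‖v‖ + ∑ j ∈ s, m j) :
    ∃ p : ι → E, ∑ i ∈ s, p i = v ∧ ∀ i ∈ s, ‖p i‖ = m i := by
  induction s using Finset.induction_on generalizing v with
  | empty => exact ⟨0, by simpa [eq_comm] using hv, by simp⟩
  | insert a s ha ih =>
    simp only [Finset.forall_mem_insert, Finset.sum_insert ha] at hm hv hs
    have hS : 0 ≤ ∑ i ∈ s, m i := Finset.sum_nonneg hm.2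
    have hv₀ := norm_nonneg v
    obtain ⟨w, hw, hwa⟩ := exists_norm_eq_norm_sub_eq hE v (a := m a)
      (r := min (∑ i ∈ s, m i) (‖v‖ + m a)) (le_min hS (by linarith))
      (by rw [← sub_le_iff_le_add]; exact le_min (by linarith) (by linarith))
      (min_le_right _ _)
      (by rw [← sub_le_iff_le_add']; exact le_min (by linarith) (by linarith))
    obtain ⟨p, hp, hpm⟩ := ih hm.2 w (hw.trans_le (min_le_left _ _)) fun i hi ↦ by
      have := Finset.single_le_sum hm.2 hi
      have := hs.2 i hi
      rw [hw, ← sub_le_iff_le_add]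
      exact le_min (by linarith) (by linarith)
    refine ⟨Function.update p a (v - w), ?_, ?_⟩
    · rw [Finset.sum_insert ha, Finset.sum_update_of_notMem ha, hp]
      simp
    · refine Finset.forall_mem_insert _ _ _ |>.2 ⟨by simpa using hwa, fun i hi ↦ ?_⟩
      rw [Function.update_of_ne (ne_of_mem_of_not_mem hi ha), hpm i hi]


/-- If positive lengths `m i` satisfy the strict polygon inequalities
`m i < ∑_{j ≠ i} m j`, then there exists a closed polygon in Euclidean 3-space
with these side lengths. -/
theorem exists_polygon_of_polygon_ineq (n : ℕ) (m : Fin n → ℝ)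
    (hpos : ∀ i, 0 < m i)
    (hpoly : ∀ i : Fin n, m i < ∑ j ∈ Finset.univ.erase i, m j) :
    ∃ p : Fin n → EuclideanSpace ℝ (Fin 3),
      ∑ i, p i = 0 ∧ ∀ i, ‖p i‖ = m i := by
  have hE : 1 < Module.rank ℝ (EuclideanSpace ℝ (Fin 3)) := by
    rw [← Module.finrank_eq_rank, finrank_euclideanSpace_fin]
    norm_num
  obtain ⟨p, hp, hpm⟩ := exists_sum_eq_norm_eq hE m Finset.univ (fun i _ ↦ (hpos i).le) 0
    (by simpa using Finset.sum_nonneg fun i _ ↦ (hpos i).le) fun i hi ↦ by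
      have := hpoly i
      rw [norm_zero, ← Finset.add_sum_erase _ _ hi]
      linarith
  exact ⟨p, hp, fun i ↦ hpm i (Finset.mem_univ i)⟩
end

section
/- Let m : Fin n → ℝ satisfy 0 < m i for all i, write M = ∑ i, m i, and assume there exists a semistable configuration p : Fin n → ℙ¹ of weight m. Then the non-strict polygon inequalities m i ≤ ∑_{j ≠ i} m j hold for all i; conversely, if m i ≤ ∑_{j ≠ i} m j for all i, then a semistable configuration of weight m exists. -/
open scoped Classical in
/-- A configuration `p : Fin n → ℙ¹` (the complex projective line) with weights `m` is
semistable if for every point `q` the total weight of the points of the configuration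
equal to `q` is at most half the total weight. -/
noncomputable def SemistableConfig {n : ℕ} (m : Fin n → ℝ)
    (p : Fin n → Projectivization ℂ (Fin 2 → ℂ)) : Prop :=
  ∀ q : Projectivization ℂ (Fin 2 → ℂ),
    ∑ i ∈ Finset.univ.filter (fun i => p i = q), m i ≤ (∑ i, m i) / 2

/-- The points `[1 : i]` of the complex projective line are pairwise distinct. -/
theorem exists_injective_projectivization (n : ℕ) :
    ∃ p : Fin n → Projectivization ℂ (Fin 2 → ℂ), Function.Injective p := by
  have hne (i : Fin n) : (![1, ((i : ℕ) : ℂ)] : Fin 2 → ℂ) ≠ 0 := fun h => by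
    simpa using congrFun h 0
  refine ⟨fun i => Projectivization.mk ℂ _ (hne i), fun i j hij => ?_⟩
  obtain ⟨a, ha⟩ := (Projectivization.mk_eq_mk_iff' ℂ _ _ (hne i) (hne j)).1 hij
  have h0 : a = 1 := by simpa using congrFun ha 0
  have h1 : a * ((j : ℕ) : ℂ) = ((i : ℕ) : ℂ) := by simpa using congrFun ha 1
  rw [h0, one_mul] at h1
  exact Fin.ext (Nat.cast_injective h1.symm)

/-- A semistable configuration of weight `m` exists if and only if the non-strict polygon
inequalities hold (stated as the two implications). -/
theorem exists_semistableConfig_iff (n : ℕ) (m : Fin n → ℝ) (hpos : ∀ i, 0 < m i) :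
    ((∃ p : Fin n → Projectivization ℂ (Fin 2 → ℂ), SemistableConfig m p) →
      ∀ i : Fin n, m i ≤ ∑ j ∈ Finset.univ.erase i, m j) ∧
    ((∀ i : Fin n, m i ≤ ∑ j ∈ Finset.univ.erase i, m j) →
      ∃ p : Fin n → Projectivization ℂ (Fin 2 → ℂ), SemistableConfig m p) := by
  classical
  have hsum (i : Fin n) : m i + ∑ j ∈ Finset.univ.erase i, m j = ∑ j, m j :=
    Finset.add_sum_erase _ _ (Finset.mem_univ i)
  constructor
  · rintro ⟨p, hp⟩ i
    have hle := Finset.single_le_sum (f := m) (s := Finset.univ.filter (fun j => p j = p i))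
      (fun j _ => (hpos j).le) (Finset.mem_filter.2 ⟨Finset.mem_univ i, rfl⟩)
    have hq : ∑ j ∈ Finset.univ.filter (fun j => p j = p i), m j ≤ (∑ j, m j) / 2 := by
      convert hp (p i)
    linarith [hsum i]
  · intro h
    obtain ⟨p, hp⟩ := exists_injective_projectivization n
    refine ⟨p, fun q => ?_⟩
    by_cases hq : ∃ i, p i = q
    · obtain ⟨i, rfl⟩ := hq
      simp only [hp.eq_iff, Finset.filter_eq', Finset.mem_univ, if_true, Finset.sum_singleton]
      linarith [hsum i, h i]
    · rw [Finset.filter_false_of_mem fun i _ hi => hq ⟨i, hi⟩, Finset.sum_empty]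
      exact div_nonneg (Finset.sum_nonneg fun i _ => (hpos i).le) zero_le_two
end

section
/- Let m : Fin n → ℝ satisfy 0 < m i for all i, and assume all signed sums are nonzero: for every ε : Fin n → ℤ with ε i = 1 or ε i = -1 for all i, ∑ i, ε i * m i ≠ 0. Then every semistable configuration p : Fin n → ℙ¹ of weight m is stable. -/
open scoped Classical in
/-- A configuration `p : Fin n → ℙ¹` with weights `m` is stable if every point of
`ℙ¹` carries strictly less than half of the total weight. -/
noncomputable def StableConfig {n : ℕ} (m : Fin n → ℝ)
    (p : Fin n → Projectivization ℂ (Fin 2 → ℂ)) : Prop :=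
  ∀ q : Projectivization ℂ (Fin 2 → ℂ),
    ∑ i ∈ Finset.univ.filter (fun i => p i = q), m i < (∑ i, m i) / 2

/-- If all signed sums `∑ i, ε i * m i` (with `ε i = ±1`) are nonzero, then every
semistable configuration of weight `m` is stable. -/
theorem stable_of_semistable_of_signed_sums_ne_zero (n : ℕ) (m : Fin n → ℝ)
    (hpos : ∀ i, 0 < m i)
    (hsigned : ∀ ε : Fin n → ℤ, (∀ i, ε i = 1 ∨ ε i = -1) →
      ∑ i, (ε i : ℝ) * m i ≠ 0)
    (p : Fin n → Projectivization ℂ (Fin 2 → ℂ)) (hp : SemistableConfig m p) :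
    StableConfig m p := by
  classical
  intro q
  refine lt_of_le_of_ne (hp q) fun heq => ?_
  refine hsigned (fun i => if p i = q then 1 else -1) (fun i => by split_ifs <;> simp) ?_
  have hterm : ∀ i, ((if p i = q then 1 else -1 : ℤ) : ℝ) * m i =
      2 * (if p i = q then m i else 0) - m i := by
    intro i
    split_ifs <;> push_cast <;> ring
  rw [Finset.sum_filter] at heq
  rw [Finset.sum_congr rfl fun i _ => hterm i, Finset.sum_sub_distrib, ← Finset.mul_sum]
  have hsum : ∑ i, (if p i = q then m i else 0) = (∑ i, m i) / 2 := by
    convert heq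
  rw [hsum]
  ring
end

section
/- Let m : Fin n → ℝ satisfy 0 < m i for all i. There exists a degenerate (collinear) closed polygon with side lengths m — that is, a vector v ∈ EuclideanSpace ℝ (Fin 3) and p : Fin n → EuclideanSpace ℝ (Fin 3) such that every p i is a scalar multiple of v, ∑ i, p i = 0, and ‖p i‖ = m i for all i — if and only if some signed sum vanishes: there exists ε : Fin n → ℝ with ε i = 1 or ε i = -1 for all i and ∑ i, ε i * m i = 0. -/
/-- A degenerate (collinear) closed polygon with side lengths `m` exists if and only if
some signed sum `∑ i, ε i * m i` with `ε i = ±1` vanishes. -/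
theorem exists_degenerate_polygon_iff (n : ℕ) (m : Fin n → ℝ) (hpos : ∀ i, 0 < m i) :
    (∃ (v : EuclideanSpace ℝ (Fin 3)) (p : Fin n → EuclideanSpace ℝ (Fin 3)),
      (∀ i, ∃ c : ℝ, p i = c • v) ∧ ∑ i, p i = 0 ∧ ∀ i, ‖p i‖ = m i) ↔
    (∃ ε : Fin n → ℝ, (∀ i, ε i = 1 ∨ ε i = -1) ∧ ∑ i, ε i * m i = 0) := by
  constructor
  · rintro ⟨v, p, hp, hsum, hnorm⟩
    choose c hc using hp
    refine ⟨fun i => if 0 ≤ c i then 1 else -1, fun i => ite_eq_or_eq _ _ _, ?_⟩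
    have hterm : ∀ i, (if 0 ≤ c i then 1 else -1) * m i = c i * ‖v‖ := by
      intro i
      rw [← hnorm i, hc i, norm_smul, Real.norm_eq_abs]
      split_ifs with h
      · rw [abs_of_nonneg h, one_mul]
      · rw [abs_of_neg (not_le.mp h)]
        ring
    simp only [hc, ← Finset.sum_smul] at hsum
    simp only [hterm, ← Finset.sum_mul]
    rcases smul_eq_zero.mp hsum with h | h <;> simp [h]
  · rintro ⟨ε, hε, hsum⟩
    refine ⟨EuclideanSpace.single 0 1, fun i => (ε i * m i) • EuclideanSpace.single 0 1,
      fun i => ⟨_, rfl⟩, ?_, fun i => ?_⟩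
    · rw [← Finset.sum_smul, hsum, zero_smul]
    · rcases hε i with h | h <;> simp [h, norm_smul, abs_of_pos (hpos i)]
end

section
/- Let m : Fin 4 → ℝ satisfy 0 < m i for all i, write M = ∑ i, m i, and assume genericity: for every way of splitting {0,1,2,3} into two pairs, the two pair sums of m are distinct. Then either there exist three distinct indices i, j, k with m i + m j > M/2, m j + m k > M/2, and m i + m k > M/2 (the 'triangle' type), or there exists an index i such that m i + m j > M/2 for every j ≠ i (the 'star' type). -/
/-- Classification of generic quadrangle spaces: for a generic positive weight vector
`m : Fin 4 → ℝ` (all splittings into two pairs have distinct pair sums), either there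
are three indices with pairwise sums exceeding `M/2` ("triangle" type), or there is one
index whose sum with each other index exceeds `M/2` ("star" type). -/
theorem quadrangle_triangle_or_star (m : Fin 4 → ℝ) (hpos : ∀ i, 0 < m i)
    (hgen : ∀ i j k l : Fin 4, ({i, j, k, l} : Finset (Fin 4)) = Finset.univ →
      m i + m j ≠ m k + m l) :
    (∃ i j k : Fin 4, i ≠ j ∧ j ≠ k ∧ i ≠ k ∧
      m i + m j > (∑ a, m a) / 2 ∧
      m j + m k > (∑ a, m a) / 2 ∧
      m i + m k > (∑ a, m a) / 2) ∨
    (∃ i : Fin 4, ∀ j : Fin 4, j ≠ i → m i + m j > (∑ a, m a) / 2) := by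
  have h01 := hgen 0 1 2 3 (by decide)
  have h02 := hgen 0 2 1 3 (by decide)
  have h03 := hgen 0 3 1 2 (by decide)
  simp only [Fin.sum_univ_four]
  rcases h01.lt_or_gt with h01 | h01 <;> rcases h02.lt_or_gt with h02 | h02 <;>
    rcases h03.lt_or_gt with h03 | h03
  · exact .inl ⟨1, 2, 3, by decide, by decide, by decide, by linarith, by linarith, by linarith⟩
  · refine .inr ⟨3, fun j hj => ?_⟩
    fin_cases j <;> simp at hj ⊢ <;> linarith
  · refine .inr ⟨2, fun j hj => ?_⟩
    fin_cases j <;> simp at hj ⊢ <;> linarith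
  · exact .inl ⟨0, 2, 3, by decide, by decide, by decide, by linarith, by linarith, by linarith⟩
  · refine .inr ⟨1, fun j hj => ?_⟩
    fin_cases j <;> simp at hj ⊢ <;> linarith
  · exact .inl ⟨0, 1, 3, by decide, by decide, by decide, by linarith, by linarith, by linarith⟩
  · exact .inl ⟨0, 1, 2, by decide, by decide, by decide, by linarith, by linarith, by linarith⟩
  · refine .inr ⟨0, fun j hj => ?_⟩
    fin_cases j <;> simp at hj ⊢ <;> linarith
end
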